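/- arXiv:1502.02354 — 5 statements merged into one kernel-verified Lean document; each statement's English description precedes it below -/
import Mathlib

section
/- Let 𝒜 be an abelian category, let 𝒞 and 𝒟 be full additive subcategories of 𝒜, let n ≥ 0, let M be an object of ^⊥𝒞, and let M′ be an object of 𝒜 for which there exists an exact sequence 0 → M″ → C_{n-1} → ⋯ → C_1 → C_0 → M′ → 0 in 𝒜 with all C_i objects in 𝒞 and M″ an object in 𝒟^⊥. If 𝒟-dim M ≤ n (in particular finite), then Ext^i_𝒜(M, M′) = 0 for every i ≥ 1. -/
open CategoryTheory CategoryTheory.Limits CategoryTheory.Abelian ZeroObject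

universe w v u

namespace RelHomDim

variable {𝒜 : Type u} [Category.{v} 𝒜] [Abelian 𝒜]

/-- A class of objects of an abelian category corresponding to a full additive
subcategory: it is closed under isomorphisms, contains a zero object and is
closed under finite direct sums (biproducts). -/
def IsAdditiveClass (P : 𝒜 → Prop) : Prop :=
  P 0 ∧ (∀ ⦃X Y : 𝒜⦄, (X ≅ Y) → P X → P Y) ∧ ∀ ⦃X Y : 𝒜⦄, P X → P Y → P (X ⊞ Y)

/-- A class of objects is closed under direct summands. -/
def ClosedUnderSummands (P : 𝒜 → Prop) : Prop :=
  ∀ X Y : 𝒜, P (X ⊞ Y) → P X ∧ P Y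

/-- `Hom(W,-)`-exactness of a short exact sequence `0 → X₁ → X₂ → X₃ → 0`:
the induced sequence `0 → Hom(W,X₁) → Hom(W,X₂) → Hom(W,X₃) → 0` is exact. -/
def CovHomExact (W : 𝒜) (S : ShortComplex 𝒜) : Prop :=
  (∀ a b : W ⟶ S.X₁, a ≫ S.f = b ≫ S.f → a = b) ∧
  (∀ b : W ⟶ S.X₂, b ≫ S.g = 0 → ∃ a : W ⟶ S.X₁, a ≫ S.f = b) ∧
  (∀ c : W ⟶ S.X₃, ∃ b : W ⟶ S.X₂, b ≫ S.g = c)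

/-- A short exact sequence is `ℰ`-proper (i.e. `Hom(ℰ,-)`-exact) if it is
`Hom(E,-)`-exact for every object `E` in the class `ℰ`. -/
def EProper (E : 𝒜 → Prop) (S : ShortComplex 𝒜) : Prop :=
  ∀ W, E W → CovHomExact W S

/-- `ResW P W n K A` holds iff there is an exact sequence
`0 → K → X_{n-1} → ⋯ → X_0 → A → 0` in `𝒜` with all the `n` middle terms `X i`
in `P`, such that each of the short exact sequences obtained by splicing
satisfies `W` (this encodes, e.g., `Hom(ℰ,-)`-exactness of the whole sequence). -/
def ResW (P : 𝒜 → Prop) (W : ShortComplex 𝒜 → Prop) : ℕ → 𝒜 → 𝒜 → Prop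
  | 0 => fun K A => Nonempty (K ≅ A)
  | n + 1 => fun K A => ∃ (B X : 𝒜) (f : B ⟶ X) (g : X ⟶ A) (w : f ≫ g = 0),
      P X ∧ (ShortComplex.mk f g w).ShortExact ∧ W (ShortComplex.mk f g w) ∧
      ResW P W n K B

/-- `Res P n K A` : there is an exact sequence `0 → K → X_{n-1} → ⋯ → X_0 → A → 0`
with all middle terms in `P`. -/
abbrev Res (P : 𝒜 → Prop) : ℕ → 𝒜 → 𝒜 → Prop := ResW P fun _ => True

/-- `CoresW P W n A K` holds iff there is an exact sequence
`0 → A → X^0 → ⋯ → X^{n-1} → K → 0` with all middle terms in `P` and each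
spliced short exact piece satisfying `W`. -/
def CoresW (P : 𝒜 → Prop) (W : ShortComplex 𝒜 → Prop) : ℕ → 𝒜 → 𝒜 → Prop
  | 0 => fun A K => Nonempty (A ≅ K)
  | n + 1 => fun A K => ∃ (X B : 𝒜) (f : A ⟶ X) (g : X ⟶ B) (w : f ≫ g = 0),
      P X ∧ (ShortComplex.mk f g w).ShortExact ∧ W (ShortComplex.mk f g w) ∧
      CoresW P W n B K

/-- `Cores P n A K` : there is an exact sequence `0 → A → X^0 → ⋯ → X^{n-1} → K → 0`
with all middle terms in `P`. -/
abbrev Cores (P : 𝒜 → Prop) : ℕ → 𝒜 → 𝒜 → Prop := CoresW P fun _ => True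

/-- The `P`-dimension of `A` : the infimum of the `n ≥ 0` such that there is
an exact sequence `0 → C_n → ⋯ → C_1 → C_0 → A → 0` with all `C_i` in `P`
(`⊤ = ∞` if there is no such `n`). -/
noncomputable def rdim (P : 𝒜 → Prop) (A : 𝒜) : ℕ∞ :=
  sInf {c : ℕ∞ | ∃ n : ℕ, c = n ∧ ∃ K, P K ∧ Res P n K A}

/-- The `P`-codimension of `A` : the infimum of the `n ≥ 0` such that there is
an exact sequence `0 → A → C^0 → C^1 → ⋯ → C^n → 0` with all `C^i` in `P`
(`⊤ = ∞` if there is no such `n`). -/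
noncomputable def rcodim (P : 𝒜 → Prop) (A : 𝒜) : ℕ∞ :=
  sInf {c : ℕ∞ | ∃ n : ℕ, c = n ∧ ∃ K, P K ∧ Cores P n A K}

/-- `A` belongs to `P^⊥`, i.e. `Ext^i(C, A) = 0` for all `C` in `P` and `i ≥ 1`. -/
def MemRightPerp [HasExt.{w} 𝒜] (P : 𝒜 → Prop) (A : 𝒜) : Prop :=
  ∀ C, P C → ∀ i : ℕ, 1 ≤ i → Subsingleton (Abelian.Ext C A i)

/-- `A` belongs to `^⊥P`, i.e. `Ext^i(A, C) = 0` for all `C` in `P` and `i ≥ 1`. -/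
def MemLeftPerp [HasExt.{w} 𝒜] (P : 𝒜 → Prop) (A : 𝒜) : Prop :=
  ∀ C, P C → ∀ i : ℕ, 1 ≤ i → Subsingleton (Abelian.Ext A C i)

/-- `𝒞` is an `ℰ`-proper generator for `𝒯` (`𝒞 ⊆ 𝒯` and every object of `𝒯`
is an `ℰ`-proper quotient of an object of `𝒞` with kernel in `𝒯`). -/
def IsProperGenerator (E C T : 𝒜 → Prop) : Prop :=
  (∀ ⦃X⦄, C X → T X) ∧
  ∀ X, T X → ∃ (X' Cb : 𝒜) (f : X' ⟶ Cb) (g : Cb ⟶ X) (w : f ≫ g = 0),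
    C Cb ∧ T X' ∧ (ShortComplex.mk f g w).ShortExact ∧ EProper E (ShortComplex.mk f g w)

/-- `𝒞` is a cogenerator for `𝒯`. -/
def IsCogenerator (C T : 𝒜 → Prop) : Prop :=
  (∀ ⦃X⦄, C X → T X) ∧
  ∀ X, T X → ∃ (Cb X' : 𝒜) (f : X ⟶ Cb) (g : Cb ⟶ X') (w : f ≫ g = 0),
    C Cb ∧ T X' ∧ (ShortComplex.mk f g w).ShortExact

/-- `𝒯` is closed under `ℰ`-proper extensions. -/
def ClosedUnderProperExtensions (E T : 𝒜 → Prop) : Prop :=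
  ∀ S : ShortComplex 𝒜, S.ShortExact → EProper E S → T S.X₁ → T S.X₃ → T S.X₂

/-- `𝒯` is closed under kernels of `ℰ`-proper epimorphisms. -/
def ClosedUnderProperKernels (E T : 𝒜 → Prop) : Prop :=
  ∀ S : ShortComplex 𝒜, S.ShortExact → EProper E S → T S.X₂ → T S.X₃ → T S.X₁

/-- `𝒯` is an `ℰ`-preresolving subcategory with `ℰ`-proper generator `𝒞`. -/
def IsPreresolving (E T C : 𝒜 → Prop) : Prop :=
  IsProperGenerator E C T ∧ ClosedUnderProperExtensions E T


/-- Exactness of a four-term sequence `0 → M → T₁ → T₀ → A → 0`. -/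
def FourTermExact {M T1 T0 A : 𝒜} (f : M ⟶ T1) (g : T1 ⟶ T0) (h : T0 ⟶ A) : Prop :=
  Mono f ∧ Epi h ∧ ∃ (w₁ : f ≫ g = 0) (w₂ : g ≫ h = 0),
    (ShortComplex.mk f g w₁).Exact ∧ (ShortComplex.mk g h w₂).Exact

/-- `Hom(W,-)`-exactness of the four-term exact sequence `0 → M → T₁ → T₀ → A → 0` :
the induced sequence `0 → Hom(W,M) → Hom(W,T₁) → Hom(W,T₀) → Hom(W,A) → 0` is exact. -/
def CovHomExact4 (W : 𝒜) {M T1 T0 A : 𝒜} (f : M ⟶ T1) (g : T1 ⟶ T0) (h : T0 ⟶ A) : Prop :=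
  (∀ a b : W ⟶ M, a ≫ f = b ≫ f → a = b) ∧
  (∀ b : W ⟶ T1, b ≫ g = 0 → ∃ a : W ⟶ M, a ≫ f = b) ∧
  (∀ c : W ⟶ T0, c ≫ h = 0 → ∃ b : W ⟶ T1, b ≫ g = c) ∧
  (∀ d : W ⟶ A, ∃ c : W ⟶ T0, c ≫ h = d)

/-- There is an exact sequence `0 → M → K⁰ → C¹ → ⋯ → Cⁿ → 0` with `K⁰` in `T`
and all `C^i` in `C`. -/
def MixedCores (T C : 𝒜 → Prop) : ℕ → 𝒜 → Prop
  | 0 => fun M => ∃ K, T K ∧ Nonempty (M ≅ K)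
  | n + 1 => fun M => ∃ (K H : 𝒜) (f : M ⟶ K) (g : K ⟶ H) (w : f ≫ g = 0),
      T K ∧ (ShortComplex.mk f g w).ShortExact ∧ ∃ K', C K' ∧ Cores C n H K'

/-- The Gorenstein subcategory `𝒢(𝒞)` : objects `A` admitting a doubly infinite
exact sequence `⋯ → X_{-1} → X_0 → X_1 → ⋯` with all terms in `𝒞`, which is both
`Hom(𝒞,-)`-exact and `Hom(-,𝒞)`-exact, such that `A ≅ Im(X_0 → X_1)`. -/
def IsGorenstein (P : 𝒜 → Prop) (A : 𝒜) : Prop :=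
  ∃ (X : ℤ → 𝒜) (d : ∀ i : ℤ, X i ⟶ X (i + 1)) (w : ∀ i, d i ≫ d (i + 1) = 0),
    (∀ i, P (X i)) ∧
    (∀ i, (ShortComplex.mk (d i) (d (i + 1)) (w i)).Exact) ∧
    (∀ C, P C → ∀ (i : ℤ) (f : C ⟶ X (i + 1)), f ≫ d (i + 1) = 0 →
      ∃ g : C ⟶ X i, g ≫ d i = f) ∧
    (∀ C, P C → ∀ (i : ℤ) (f : X (i + 1) ⟶ C), d i ≫ f = 0 →
      ∃ g : X (i + 1 + 1) ⟶ C, d (i + 1) ≫ g = f) ∧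
    Nonempty (A ≅ Limits.image (d 0))

end RelHomDim

namespace RelHomDim

variable {𝒜 : Type u} [Category.{v} 𝒜] [Abelian 𝒜]

theorem subsingleton_ext_of_iso_right [HasExt.{w} 𝒜] {X Y Y' : 𝒜} (e : Y ≅ Y') {i : ℕ}
    (h : Subsingleton (Abelian.Ext X Y i)) : Subsingleton (Abelian.Ext X Y' i) := by
  refine subsingleton_of_forall_eq 0 fun x => ?_
  have hx : x.comp (Abelian.Ext.mk₀ e.inv) (add_zero i) = 0 := Subsingleton.elim _ _
  have hx' := congrArg (fun y => y.comp (Abelian.Ext.mk₀ e.hom) (add_zero i)) hx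
  simpa using hx'

theorem covariant_subsingleton_ext_X₃ [HasExt.{w} 𝒜] {S : ShortComplex 𝒜} (hS : S.ShortExact) (X : 𝒜)
    {i : ℕ} (h₂ : Subsingleton (Abelian.Ext X S.X₂ i))
    (h₁ : Subsingleton (Abelian.Ext X S.X₁ (i + 1))) :
    Subsingleton (Abelian.Ext X S.X₃ i) := by
  refine subsingleton_of_forall_eq 0 fun x => ?_
  obtain ⟨y, rfl⟩ := Abelian.Ext.covariant_sequence_exact₃ X hS x rfl (Subsingleton.elim _ _)
  rw [Subsingleton.elim y 0, Abelian.Ext.zero_comp]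

theorem contravariant_subsingleton_ext_X₃ [HasExt.{w} 𝒜] {S : ShortComplex 𝒜} (hS : S.ShortExact) (Y : 𝒜)
    {i : ℕ} (h₁ : Subsingleton (Abelian.Ext S.X₁ Y i))
    (h₂ : Subsingleton (Abelian.Ext S.X₂ Y (i + 1))) :
    Subsingleton (Abelian.Ext S.X₃ Y (i + 1)) := by
  refine subsingleton_of_forall_eq 0 fun x => ?_
  obtain ⟨y, rfl⟩ := Abelian.Ext.contravariant_sequence_exact₃ hS Y x (Subsingleton.elim _ _)
    (add_comm 1 i)
  rw [Subsingleton.elim y 0, Abelian.Ext.comp_zero]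

/-- Dimension shifting in the first variable along a finite `P`-resolution. -/
theorem MemRightPerp.subsingleton_ext_of_res [HasExt.{w} 𝒜] {P : 𝒜 → Prop}
    (hP : ∀ ⦃X Y : 𝒜⦄, (X ≅ Y) → P X → P Y) {Y K : 𝒜} (hY : MemRightPerp P Y) (hK : P K)
    {m : ℕ} {A : 𝒜} (hA : Res P m K A) {i : ℕ} (hi : m + 1 ≤ i) :
    Subsingleton (Abelian.Ext A Y i) := by
  induction m generalizing A i with
  | zero =>
    obtain ⟨e⟩ := hA
    exact hY A (hP e hK) i (by lia)
  | succ m ih =>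
    obtain ⟨B, X, f, g, w, hX, hS, -, hB⟩ := hA
    obtain ⟨j, rfl⟩ : ∃ j, i = j + 1 := ⟨i - 1, by lia⟩
    exact contravariant_subsingleton_ext_X₃ hS Y (ih hB (by lia)) (hY X hX _ (by lia))

/-- Dimension shifting in the second variable along a finite `P`-resolution. -/
theorem MemLeftPerp.subsingleton_ext_of_res [HasExt.{w} 𝒜] {P : 𝒜 → Prop} {M K : 𝒜}
    (hM : MemLeftPerp P M) {n : ℕ} {A : 𝒜} (hA : Res P n K A) {i : ℕ} (hi : 1 ≤ i)
    (hK : Subsingleton (Abelian.Ext M K (i + n))) : Subsingleton (Abelian.Ext M A i) := by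
  induction n generalizing A i with
  | zero =>
    obtain ⟨e⟩ := hA
    exact subsingleton_ext_of_iso_right e hK
  | succ n ih =>
    obtain ⟨B, X, f, g, w, hX, hS, -, hB⟩ := hA
    refine covariant_subsingleton_ext_X₃ hS M (hM X hX i hi) (ih hB (by lia) ?_)
    rwa [add_assoc, add_comm 1 n]

theorem exists_res_of_rdim_le {P : 𝒜 → Prop} {A : 𝒜} {n : ℕ} (h : rdim P A ≤ n) :
    ∃ m ≤ n, ∃ K, P K ∧ Res P m K A := by
  have hne : {c : ℕ∞ | ∃ n : ℕ, c = n ∧ ∃ K, P K ∧ Res P n K A}.Nonempty := by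
    by_contra hne
    rw [Set.not_nonempty_iff_eq_empty] at hne
    simp [rdim, hne] at h
  obtain ⟨m, hm, hK⟩ := csInf_mem hne
  refine ⟨m, ?_, hK⟩
  rw [rdim, hm] at h
  exact_mod_cast h

end RelHomDim

open RelHomDim in
/-- Lemma 2.2: if `M ∈ ^⊥𝒞`, `M'` admits an exact sequence
`0 → M'' → C_{n-1} → ⋯ → C_0 → M' → 0` with the `C_i` in `𝒞` and `M'' ∈ 𝒟^⊥`,
and `𝒟`-dim `M ≤ n`, then `Ext^i(M, M') = 0` for all `i ≥ 1`. -/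
theorem stmt0 {𝒜 : Type u} [Category.{v} 𝒜] [Abelian 𝒜] [HasExt.{w} 𝒜]
    (𝒞 𝒟 : 𝒜 → Prop) (h𝒞 : IsAdditiveClass 𝒞) (h𝒟 : IsAdditiveClass 𝒟)
    (n : ℕ) (M M' : 𝒜)
    (hM : MemLeftPerp 𝒞 M)
    (hM' : ∃ M'' : 𝒜, MemRightPerp 𝒟 M'' ∧ Res 𝒞 n M'' M')
    (hdim : rdim 𝒟 M ≤ (n : ℕ∞)) :
    ∀ i : ℕ, 1 ≤ i → Subsingleton (Abelian.Ext M M' i) := by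
  obtain ⟨M'', hM'', hres⟩ := hM'
  obtain ⟨m, hm, K, hK, hKM⟩ := exists_res_of_rdim_le hdim
  intro i hi
  exact hM.subsingleton_ext_of_res hres hi
    (hM''.subsingleton_ext_of_res h𝒟.2.1 hK hKM (by lia))
end

section
/- Let 𝒜 be an abelian category and 𝒞 a full additive subcategory such that 𝒞⊥𝒞 holds and the class of objects of finite 𝒞-dimension is closed under direct summands. Let 0 → K → C → A → 0 be an exact sequence in 𝒜 with 𝒞-dim A < ∞ and C an object in 𝒞. If K is an object in 𝒞^⊥, then 𝒞-dim K < ∞. -/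
open CategoryTheory CategoryTheory.Limits CategoryTheory.Abelian ZeroObject

universe w v u

namespace RelHomDim

variable {𝒜 : Type u} [Category.{v} 𝒜] [Abelian 𝒜]

lemma rdim_lt_top_iff {P : 𝒜 → Prop} {A : 𝒜} :
    rdim P A < ⊤ ↔ ∃ (n : ℕ) (K : 𝒜), P K ∧ Res P n K A := by
  rw [rdim, sInf_lt_iff]
  constructor
  · rintro ⟨_, ⟨n, -, K, hK, h⟩, -⟩
    exact ⟨n, K, hK, h⟩
  · rintro ⟨n, K, hK, h⟩
    exact ⟨n, ⟨n, rfl, K, hK, h⟩, WithTop.coe_lt_top n⟩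

lemma Res.ofIso {P : 𝒜 → Prop} {n : ℕ} {K A A' : 𝒜} (h : Res P n K A) (e : A ≅ A') :
    Res P n K A' := by
  cases n with
  | zero => exact h.map fun e' => e' ≪≫ e
  | succ n =>
    obtain ⟨B, X, f, g, w, hX, hse, -, hB⟩ := h
    refine ⟨B, X, f, g ≫ e.hom, by simp [reassoc_of% w], hX, ?_, trivial, hB⟩
    exact ShortComplex.shortExact_of_iso (S₁ := ShortComplex.mk f g w)
      (ShortComplex.isoMk (Iso.refl _) (Iso.refl _) e (by simp) (by simp)) hse

lemma rdim_lt_top_of_iso {P : 𝒜 → Prop} {A A' : 𝒜} (h : rdim P A < ⊤) (e : A ≅ A') :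
    rdim P A' < ⊤ := by
  rw [rdim_lt_top_iff] at h ⊢
  obtain ⟨n, K, hK, h⟩ := h
  exact ⟨n, K, hK, Res.ofIso h e⟩

lemma rdim_lt_top_of_mem {P : 𝒜 → Prop} {A : 𝒜} (h : P A) : rdim P A < ⊤ :=
  rdim_lt_top_iff.2 ⟨0, A, h, ⟨Iso.refl A⟩⟩

/-- Adding a direct summand to the middle and right terms preserves short exactness. -/
lemma shortExact_biprod_right {B X A : 𝒜} {f : B ⟶ X} {g : X ⟶ A} {w : f ≫ g = 0}
    (hse : (ShortComplex.mk f g w).ShortExact) (C : 𝒜) :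
    (ShortComplex.mk (f ≫ (biprod.inl : X ⟶ X ⊞ C)) (biprod.map g (𝟙 C))
      (by simp [reassoc_of% w])).ShortExact := by
  have : Mono f := hse.mono_f
  have : Epi g := hse.epi_g
  have hk (T : 𝒜) (k : T ⟶ X ⊞ C) (hk : k ≫ biprod.map g (𝟙 C) = 0) :
      (k ≫ biprod.fst) ≫ g = 0 ∧ k ≫ biprod.snd = 0 :=
    ⟨by simpa using hk =≫ biprod.fst, by simpa using hk =≫ biprod.snd⟩
  refine ShortComplex.ShortExact.mk' (ShortComplex.exact_of_f_is_kernel _ ?_)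
    (mono_comp f _) ?_
  · refine KernelFork.IsLimit.ofι' _ _ fun {T} k hk' =>
      ⟨hse.exact.lift (k ≫ biprod.fst) (hk T k hk').1, ?_⟩
    have h₁ := hse.exact.lift_f (k ≫ biprod.fst) (hk T k hk').1
    dsimp at h₁ ⊢
    apply biprod.hom_ext
    · simpa using h₁
    · simp [(hk T k hk').2]
  · dsimp
    infer_instance

lemma rdim_biprod_lt_top {P : 𝒜 → Prop} (hP : IsAdditiveClass P) {B C : 𝒜}
    (hB : rdim P B < ⊤) (hC : P C) : rdim P (B ⊞ C) < ⊤ := by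
  obtain ⟨n, K, hK, h⟩ := rdim_lt_top_iff.1 hB
  cases n with
  | zero =>
    obtain ⟨e⟩ := h
    exact rdim_lt_top_of_mem (hP.2.2 (hP.2.1 e hK) hC)
  | succ n =>
    obtain ⟨B', X, f, g, w, hX, hse, -, hB'⟩ := h
    exact rdim_lt_top_iff.2 ⟨n + 1, K, hK, B', X ⊞ C, _, _, _, hP.2.2 hX hC,
      shortExact_biprod_right hse C, trivial, hB'⟩

/-- An object of finite dimension is a quotient of an object of the class, with kernel of
finite dimension. -/
lemma exists_shortExact_of_rdim_lt_top {P : 𝒜 → Prop} (hP : IsAdditiveClass P) {A : 𝒜}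
    (hA : rdim P A < ⊤) :
    ∃ (B X : 𝒜) (f : B ⟶ X) (g : X ⟶ A) (w : f ≫ g = 0),
      P X ∧ rdim P B < ⊤ ∧ (ShortComplex.mk f g w).ShortExact := by
  obtain ⟨n, K, hK, h⟩ := rdim_lt_top_iff.1 hA
  cases n with
  | zero =>
    obtain ⟨e⟩ := h
    refine ⟨0, A, 0, 𝟙 A, zero_comp, hP.2.1 e hK, rdim_lt_top_of_mem hP.1, ?_⟩
    exact (ShortComplex.Splitting.mk (S := ShortComplex.mk (0 : (0 : 𝒜) ⟶ A) (𝟙 A) zero_comp)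
      0 (𝟙 A) (by ext) (by simp) (by simp)).shortExact
  | succ n =>
    obtain ⟨B, X, f, g, w, hX, hse, -, hB⟩ := h
    exact ⟨B, X, f, g, w, hX, rdim_lt_top_iff.2 ⟨n, K, hK, hB⟩, hse⟩

section Ext

variable [HasExt.{w} 𝒜]

lemma memRightPerp_of_res {P : 𝒜 → Prop} (hP : IsAdditiveClass P)
    (horth : ∀ C, P C → MemRightPerp P C) {n : ℕ} {K A : 𝒜} (hK : P K) (h : Res P n K A) :
    MemRightPerp P A := by
  induction n generalizing A with
  | zero =>
    obtain ⟨e⟩ := h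
    exact horth _ (hP.2.1 e hK)
  | succ n ih =>
    obtain ⟨B, X, f, g, w, hX, hse, -, hB⟩ := h
    intro C hC i hi
    have := ih hB C hC (i + 1) (by lia)
    have := horth X hX C hC i hi
    refine subsingleton_of_forall_eq 0 fun x => ?_
    obtain ⟨y, rfl⟩ := Ext.covariant_sequence_exact₃ C hse x rfl (Subsingleton.elim _ _)
    rw [Subsingleton.elim y 0, Ext.zero_comp]

lemma memRightPerp_of_rdim_lt_top {P : 𝒜 → Prop} (hP : IsAdditiveClass P)
    (horth : ∀ C, P C → MemRightPerp P C) {A : 𝒜} (hA : rdim P A < ⊤) : MemRightPerp P A := by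
  obtain ⟨n, K, hK, h⟩ := rdim_lt_top_iff.1 hA
  exact memRightPerp_of_res hP horth hK h

/-- A morphism lifts along an epimorphism when `Ext¹` into the kernel vanishes. -/
lemma exists_lift_of_subsingleton_ext {S : ShortComplex 𝒜} (hS : S.ShortExact) {X : 𝒜}
    [Subsingleton (Ext X S.X₁ 1)] (p : X ⟶ S.X₃) : ∃ t : X ⟶ S.X₂, t ≫ S.g = p := by
  obtain ⟨y, hy⟩ := Ext.covariant_sequence_exact₃ X hS (Ext.mk₀ p) (zero_add 1)
    (Subsingleton.elim _ _)
  obtain ⟨t, rfl⟩ := (Ext.mk₀_bijective X S.X₂).surjective y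
  rw [Ext.mk₀_comp_mk₀] at hy
  exact ⟨t, (Ext.mk₀_bijective X S.X₃).injective hy⟩

end Ext

/-- The pullback of an epimorphism along a morphism which lifts splits. -/
noncomputable def biprodIsoPullback {S : ShortComplex 𝒜} (hS : S.ShortExact) {X : 𝒜}
    (p : X ⟶ S.X₃) (t : X ⟶ S.X₂) (ht : t ≫ S.g = p) : S.X₁ ⊞ X ≅ pullback S.g p :=
  have : Mono S.f := hS.mono_f
  have hl : (pullback.fst S.g p - pullback.snd S.g p ≫ t) ≫ S.g = 0 := by
    simp [ht, pullback.condition]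
  { hom := biprod.desc (pullback.lift S.f 0 (by simp)) (pullback.lift t (𝟙 X) (by simp [ht]))
    inv := biprod.lift (hS.exact.lift _ hl) (pullback.snd S.g p)
    hom_inv_id := by
      ext <;> simp [← cancel_mono S.f, pullback.lift_fst, pullback.lift_snd,
        pullback.lift_snd_assoc]
    inv_hom_id := by
      ext <;> simp [pullback.lift_fst, pullback.lift_snd] }

end RelHomDim

open RelHomDim in
/-- Lemma 2.4. -/
theorem stmt2 {𝒜 : Type u} [Category.{v} 𝒜] [Abelian 𝒜] [HasExt.{w} 𝒜]
    (𝒞 : 𝒜 → Prop) (h𝒞 : IsAdditiveClass 𝒞)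
    (horth : ∀ C₁ C₂ : 𝒜, 𝒞 C₁ → 𝒞 C₂ → ∀ i : ℕ, 1 ≤ i →
      Subsingleton (Abelian.Ext C₁ C₂ i))
    (hsum : ClosedUnderSummands (fun X : 𝒜 => rdim 𝒞 X < ⊤))
    {K C A : 𝒜} (f : K ⟶ C) (g : C ⟶ A) (w : f ≫ g = 0)
    (hse : (ShortComplex.mk f g w).ShortExact)
    (hA : rdim 𝒞 A < ⊤) (hC : 𝒞 C) (hK : MemRightPerp 𝒞 K) :
    rdim 𝒞 K < ⊤ := by
  obtain ⟨B, X, j, p, w', hX, hB, hse'⟩ := exists_shortExact_of_rdim_lt_top h𝒞 hA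
  have : Subsingleton (Ext X K 1) := hK X hX 1 le_rfl
  have : Subsingleton (Ext C B 1) := memRightPerp_of_rdim_lt_top h𝒞
    (fun C₂ h₂ C₁ h₁ => horth C₁ C₂ h₁ h₂) hB C hC 1 le_rfl
  obtain ⟨t, ht⟩ := exists_lift_of_subsingleton_ext hse p
  obtain ⟨s, hs⟩ := exists_lift_of_subsingleton_ext hse' g
  exact (hsum K X (rdim_lt_top_of_iso (rdim_biprod_lt_top h𝒞 hB hC)
    (biprodIsoPullback hse' g s hs ≪≫ pullbackSymmetry p g ≪≫
      (biprodIsoPullback hse p t ht).symm))).1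
end

section
/- Let 𝒜 be an abelian category and 𝒞 ⊆ 𝒯 full additive subcategories of 𝒜 such that 𝒞 is a cogenerator for 𝒯. Let 0 → A₁ → A₂ → A₃ → 0 be an exact sequence in 𝒜 such that both A₂ and A₃ are objects in 𝒯^⊥. If A₁ is an object in 𝒞^⊥, then A₁ is an object in 𝒯^⊥. -/
open CategoryTheory CategoryTheory.Limits CategoryTheory.Abelian ZeroObject

universe w v u

/-- In the covariant long exact sequence of `0 → X₁ → X₂ → X₃ → 0`, the group `Ext^(n+1)(Y, X₁)`
vanishes if its two neighbours do. -/
theorem CategoryTheory.ShortComplex.ShortExact.subsingleton_ext_X₁_of_covariant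
    {𝒜 : Type u} [Category.{v} 𝒜] [Abelian 𝒜] [HasExt.{w} 𝒜]
    {S : ShortComplex 𝒜} (hS : S.ShortExact) (Y : 𝒜) (n : ℕ)
    (h₃ : Subsingleton (Abelian.Ext Y S.X₃ n)) (h₂ : Subsingleton (Abelian.Ext Y S.X₂ (n + 1))) :
    Subsingleton (Abelian.Ext Y S.X₁ (n + 1)) := by
  refine subsingleton_of_forall_eq 0 fun x => ?_
  obtain ⟨y, rfl⟩ := Ext.covariant_sequence_exact₁ Y hS x (Subsingleton.elim _ _) rfl
  rw [Subsingleton.elim y 0, Ext.zero_comp]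

/-- In the contravariant long exact sequence of `0 → X₁ → X₂ → X₃ → 0`, the group `Ext^n(X₁, Y)`
vanishes if its two neighbours do. -/
theorem CategoryTheory.ShortComplex.ShortExact.subsingleton_ext_X₁_of_contravariant
    {𝒜 : Type u} [Category.{v} 𝒜] [Abelian 𝒜] [HasExt.{w} 𝒜]
    {S : ShortComplex 𝒜} (hS : S.ShortExact) (Y : 𝒜) (n : ℕ)
    (h₂ : Subsingleton (Abelian.Ext S.X₂ Y n)) (h₃ : Subsingleton (Abelian.Ext S.X₃ Y (1 + n))) :
    Subsingleton (Abelian.Ext S.X₁ Y n) := by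
  refine subsingleton_of_forall_eq 0 fun x => ?_
  obtain ⟨y, rfl⟩ := Ext.contravariant_sequence_exact₁ hS Y x rfl (Subsingleton.elim _ _)
  rw [Subsingleton.elim y 0, Ext.comp_zero]

open RelHomDim in
/-- Lemma 2.6. -/
theorem stmt3 {𝒜 : Type u} [Category.{v} 𝒜] [Abelian 𝒜] [HasExt.{w} 𝒜]
    (𝒞 𝒯 : 𝒜 → Prop) (h𝒞 : IsAdditiveClass 𝒞) (h𝒯 : IsAdditiveClass 𝒯)
    (hcog : IsCogenerator 𝒞 𝒯)
    {A₁ A₂ A₃ : 𝒜} (f : A₁ ⟶ A₂) (g : A₂ ⟶ A₃) (w : f ≫ g = 0)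
    (hse : (ShortComplex.mk f g w).ShortExact)
    (h2 : MemRightPerp 𝒯 A₂) (h3 : MemRightPerp 𝒯 A₃)
    (h1 : MemRightPerp 𝒞 A₁) :
    MemRightPerp 𝒯 A₁ := by
  have two_le (T : 𝒜) (hT : 𝒯 T) (n : ℕ) : Subsingleton (Ext T A₁ (n + 2)) :=
    hse.subsingleton_ext_X₁_of_covariant T (n + 1) (h3 T hT _ (by omega)) (h2 T hT _ (by omega))
  intro T hT i hi
  obtain _ | _ | n := i
  · omega
  · obtain ⟨C, T', a, b, hab, hC, hT', hS⟩ := hcog.2 T hT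
    exact hS.subsingleton_ext_X₁_of_contravariant A₁ 1 (h1 C hC 1 le_rfl) (two_le T' hT' 0)
  · exact two_le T hT n
end

section
/- Let 𝒜 be an abelian category, ℰ a full additive subcategory, and 𝒯 an ℰ-preresolving subcategory of 𝒜 admitting an ℰ-proper generator 𝒞. Let n ≥ 1 and let 0 → M → T_{n-1} → T_{n-2} → ⋯ → T₀ → A → 0 be an exact sequence in 𝒜 with all T_i objects in 𝒯. Then there exist an exact sequence 0 → N → C_{n-1} → C_{n-2} → ⋯ → C₀ → A → 0 and a Hom_𝒜(ℰ,−)-exact exact sequence 0 → T → N → M → 0 in 𝒜 with all C_i objects in 𝒞 and T an object in 𝒯. In particular, an object of 𝒜 is an n-𝒞-cosyzygy if and only if it is an n-𝒯-cosyzygy. -/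
open CategoryTheory CategoryTheory.Limits CategoryTheory.Abelian ZeroObject

universe w v u

namespace RelHomDim

variable {𝒜 : Type u} [Category.{v} 𝒜] [Abelian 𝒜]

lemma shortExact_of_lift {X Y Z : 𝒜} {f : X ⟶ Y} {g : Y ⟶ Z} (w : f ≫ g = 0) [Mono f] [Epi g]
    (h : ∀ {W : 𝒜} (b : W ⟶ Y), b ≫ g = 0 → ∃ a : W ⟶ X, a ≫ f = b) :
    (ShortComplex.mk f g w).ShortExact where
  exact := ShortComplex.exact_of_f_is_kernel _ <|
    KernelFork.IsLimit.ofι' f w fun b hb => ⟨(h b hb).choose, (h b hb).choose_spec⟩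

lemma eProper_of_lift {E : 𝒜 → Prop} {S : ShortComplex 𝒜} (hS : S.ShortExact)
    (h : ∀ W, E W → ∀ c : W ⟶ S.X₃, ∃ b : W ⟶ S.X₂, b ≫ S.g = c) : EProper E S := by
  have := hS.mono_f
  exact fun W hW => ⟨fun a b => (cancel_mono S.f).1,
    fun b hb => ⟨hS.exact.lift b hb, hS.exact.lift_f b hb⟩, h W hW⟩

/-- The pullback of a short exact sequence `0 → X → Y → Z → 0` along `Z' ⟶ Z`. -/
lemma exists_shortExact_of_isPullback {X Y Z P Z' : 𝒜} {f : X ⟶ Y} {g : Y ⟶ Z} {w : f ≫ g = 0}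
    (hS : (ShortComplex.mk f g w).ShortExact) {k : P ⟶ Y} {g' : P ⟶ Z'} {h : Z' ⟶ Z}
    (hP : IsPullback k g' g h) :
    ∃ (f' : X ⟶ P) (w' : f' ≫ g' = 0), (ShortComplex.mk f' g' w').ShortExact := by
  have : Mono f := hS.mono_f
  have : Epi g := hS.epi_g
  have : Epi g' := Abelian.epi_snd_of_isLimit _ _ hP.isLimit
  have hf : hP.lift f 0 (by simp [w]) ≫ k = f := hP.lift_fst _ _ _
  have hf' : hP.lift f 0 (by simp [w]) ≫ g' = 0 := hP.lift_snd _ _ _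
  have : Mono (hP.lift f 0 (by simp [w])) := by
    have : Mono (hP.lift f 0 (by simp [w]) ≫ k) := by rwa [hf]
    exact mono_of_mono _ k
  refine ⟨_, hf', shortExact_of_lift hf' fun b hb => ?_⟩
  have hb' : (b ≫ k) ≫ g = 0 := by
    rw [Category.assoc, hP.w, reassoc_of% hb, zero_comp]
  refine ⟨hS.exact.lift (b ≫ k) hb', hP.hom_ext ?_ ?_⟩
  · rw [Category.assoc, hf]
    exact hS.exact.lift_f _ _
  · rw [Category.assoc, hf', comp_zero, hb]

lemma EProper.of_isPullback {E : 𝒜 → Prop} {X Y Z P X' Z' : 𝒜} {f : X ⟶ Y} {g : Y ⟶ Z}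
    {w : f ≫ g = 0} (hE : EProper E (ShortComplex.mk f g w)) {k : P ⟶ Y} {g' : P ⟶ Z'}
    {h : Z' ⟶ Z} (hP : IsPullback k g' g h) {f' : X' ⟶ P} {w' : f' ≫ g' = 0}
    (hS' : (ShortComplex.mk f' g' w').ShortExact) : EProper E (ShortComplex.mk f' g' w') := by
  refine eProper_of_lift hS' fun W hW c => ?_
  obtain ⟨b, hb⟩ := (hE W hW).2.2 (c ≫ h)
  exact ⟨hP.lift b c hb, hP.lift_snd _ _ _⟩

/-- If `Y → Z` is an epimorphism and `0 → B → Z → A → 0` is exact, then so is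
`0 → B ×_Z Y → Y → A → 0`. -/
lemma shortExact_comp_of_isPullback {B Z A Y P : 𝒜} {f : B ⟶ Z} {g : Z ⟶ A} {w : f ≫ g = 0}
    (hS : (ShortComplex.mk f g w).ShortExact) {p : Y ⟶ Z} [Epi p] {k : P ⟶ Y} {q : P ⟶ B}
    (hP : IsPullback k q p f) :
    ∃ w' : k ≫ p ≫ g = 0, (ShortComplex.mk k (p ≫ g) w').ShortExact := by
  have : Mono f := hS.mono_f
  have : Epi g := hS.epi_g
  have : Mono k := ⟨fun a b hab => hP.hom_ext hab <| (cancel_mono f).1 <| by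
    simp only [Category.assoc, ← hP.w, reassoc_of% hab]⟩
  have w' : k ≫ p ≫ g = 0 := by rw [hP.w_assoc, w, comp_zero]
  refine ⟨w', shortExact_of_lift w' fun b hb => ?_⟩
  have hb' : (b ≫ p) ≫ g = 0 := by rw [Category.assoc, hb]
  exact ⟨hP.lift b (hS.exact.lift (b ≫ p) hb') (hS.exact.lift_f _ _).symm, hP.lift_fst _ _ _⟩

lemma ResW.mono {P Q : 𝒜 → Prop} {W : ShortComplex 𝒜 → Prop} (hPQ : ∀ ⦃X⦄, P X → Q X) :
    ∀ {n : ℕ} {K A : 𝒜}, ResW P W n K A → ResW Q W n K A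
  | 0, _, _, h => h
  | _ + 1, _, _, ⟨B, X, f, g, w, hX, hS, hW, h⟩ => ⟨B, X, f, g, w, hPQ hX, hS, hW, h.mono hPQ⟩

/-- The first term of a `T`-resolution can be pulled back along a proper epimorphism with
kernel in `T`. -/
lemma Res.of_eProper {E T : 𝒜 → Prop} (hT : ClosedUnderProperExtensions E T) {n : ℕ}
    {M B X N : 𝒜} (hres : Res T (n + 1) M B) {f : X ⟶ N} {g : N ⟶ B} {w : f ≫ g = 0}
    (hX : T X) (hS : (ShortComplex.mk f g w).ShortExact)
    (hE : EProper E (ShortComplex.mk f g w)) : Res T (n + 1) M N := by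
  obtain ⟨B', T₁, i, p, wi, hT₁, hi, -, hres⟩ := hres
  have hP := IsPullback.of_hasPullback g p
  obtain ⟨f', w', hS'⟩ := exists_shortExact_of_isPullback hS hP
  obtain ⟨i', wi', hi'⟩ := exists_shortExact_of_isPullback hi hP.flip
  exact ⟨B', _, i', _, wi', hT _ hS' (hE.of_isPullback hP hS') hX hT₁, hi', trivial, hres⟩

lemma exists_res_generator {E T C : 𝒜 → Prop} (hpre : IsPreresolving E T C) (n : ℕ) :
    ∀ {M A : 𝒜}, Res T (n + 1) M A →
      ∃ (N X : 𝒜) (f : X ⟶ N) (g : N ⟶ M) (w : f ≫ g = 0),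
        T X ∧ (ShortComplex.mk f g w).ShortExact ∧
        EProper E (ShortComplex.mk f g w) ∧ Res C (n + 1) N A := by
  induction n with
  | zero =>
    rintro M A ⟨B, T₀, i, p, wi, hT₀, hi, -, ⟨e⟩⟩
    obtain ⟨X, C₀, f, g, w, hC₀, hX, hS, hE⟩ := hpre.1.2 T₀ hT₀
    have : Epi g := hS.epi_g
    have hP : IsPullback (pullback.fst g i) (pullback.snd g i ≫ e.inv) g (e.hom ≫ i) :=
      (IsPullback.of_hasPullback g i).of_iso (Iso.refl _) (Iso.refl _) e.symm (Iso.refl _)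
        (by simp) (by simp) (by simp) (by simp)
    obtain ⟨f', w', hS'⟩ := exists_shortExact_of_isPullback hS hP
    obtain ⟨wk, hk⟩ := shortExact_comp_of_isPullback hi (IsPullback.of_hasPullback g i)
    exact ⟨_, X, f', _, w', hX, hS', hE.of_isPullback hP hS',
      _, C₀, _, _, wk, hC₀, hk, trivial, ⟨Iso.refl _⟩⟩
  | succ n ih =>
    rintro M A ⟨B, T₀, i, p, wi, hT₀, hi, -, hres⟩
    obtain ⟨X, C₀, f, g, w, hC₀, hX, hS, hE⟩ := hpre.1.2 T₀ hT₀
    have : Epi g := hS.epi_g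
    have hP := IsPullback.of_hasPullback g i
    obtain ⟨f', w', hS'⟩ := exists_shortExact_of_isPullback hS hP
    obtain ⟨wk, hk⟩ := shortExact_comp_of_isPullback hi hP
    obtain ⟨N, Y, a, b, wab, hY, hab, hEab, hN⟩ :=
      ih (Res.of_eProper hpre.2 hres hX hS' (hE.of_isPullback hP hS'))
    exact ⟨N, Y, a, b, wab, hY, hab, hEab, _, C₀, _, _, wk, hC₀, hk, trivial, hN⟩

end RelHomDim


open RelHomDim in
/-- Proposition 3.4. -/
theorem stmt6 {𝒜 : Type u} [Category.{v} 𝒜] [Abelian 𝒜]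
    (ℰ 𝒯 𝒞 : 𝒜 → Prop) (hℰ : IsAdditiveClass ℰ) (h𝒯 : IsAdditiveClass 𝒯)
    (h𝒞 : IsAdditiveClass 𝒞) (hpre : IsPreresolving ℰ 𝒯 𝒞)
    (n : ℕ) (hn : 1 ≤ n) {M A : 𝒜} (hres : Res 𝒯 n M A) :
    (∃ (N T : 𝒜) (f : T ⟶ N) (g : N ⟶ M) (w : f ≫ g = 0),
      𝒯 T ∧ (ShortComplex.mk f g w).ShortExact ∧
      EProper ℰ (ShortComplex.mk f g w) ∧ Res 𝒞 n N A) ∧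
    ∀ B : 𝒜, (∃ M' : 𝒜, Res 𝒞 n M' B) ↔ (∃ M' : 𝒜, Res 𝒯 n M' B) := by
  obtain ⟨n, rfl⟩ := Nat.exists_eq_succ_of_ne_zero (Nat.one_le_iff_ne_zero.1 hn)
  refine ⟨exists_res_generator hpre n hres, fun B => ⟨?_, ?_⟩⟩
  · rintro ⟨M', h⟩
    exact ⟨M', ResW.mono hpre.1.1 h⟩
  · rintro ⟨M', h⟩
    obtain ⟨N, _, _, _, _, _, _, _, hN⟩ := exists_res_generator hpre n h
    exact ⟨N, hN⟩
end

section
/- Let 𝒜 be an abelian category, ℰ a full additive subcategory, 𝒯 an ℰ-preresolving subcategory of 𝒜 admitting an ℰ-proper generator 𝒞, and 𝒟 a full additive subcategory of 𝒜 such that 𝒯 ⊆ ^⊥𝒞 ∩ 𝒟^⊥. Assume that for every n ≥ 0 the class of objects with 𝒞-codimension at most n is closed under direct summands. If M is an object of 𝒜 with 𝒟-dim M < ∞, then 𝒯-codim M = 𝒞-codim M. -/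
open CategoryTheory CategoryTheory.Limits CategoryTheory.Abelian ZeroObject

universe w v u

namespace RelHomDim

section Pullback

variable {𝒜 : Type u} [Category.{v} 𝒜] [Abelian 𝒜]

/-- The short complex obtained by pulling back a short complex along a morphism to its
third object. -/
noncomputable abbrev pullbackComplex (S : ShortComplex 𝒜) {Y : 𝒜} (h : Y ⟶ S.X₃) :
    ShortComplex 𝒜 :=
  ShortComplex.mk (pullback.lift (f := S.g) (g := h) S.f 0 (by simp))
    (pullback.snd S.g h) (pullback.lift_snd _ _ _)

lemma pullbackComplex_shortExact {S : ShortComplex 𝒜} (hS : S.ShortExact) {Y : 𝒜}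
    (h : Y ⟶ S.X₃) : (pullbackComplex S h).ShortExact := by
  have := hS.mono_f
  have := hS.epi_g
  have : Mono (pullbackComplex S h).f := by
    have : Mono ((pullbackComplex S h).f ≫ pullback.fst S.g h) := by
      rwa [pullback.lift_fst]
    exact mono_of_mono _ (pullback.fst S.g h)
  have : Epi (pullbackComplex S h).g := inferInstanceAs (Epi (pullback.snd S.g h))
  refine ⟨ShortComplex.exact_of_f_is_kernel _
    (KernelFork.IsLimit.ofι' _ _ fun {W} k hk => ⟨hS.exact.lift (k ≫ pullback.fst S.g h) ?_, ?_⟩)⟩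
  · rw [Category.assoc, pullback.condition, reassoc_of% hk, zero_comp]
  · apply pullback.hom_ext
    · simp [pullback.lift_fst]
    · simpa [pullback.lift_snd] using hk.symm

lemma covHomExact_of_shortExact {W : 𝒜} {S : ShortComplex 𝒜} (hS : S.ShortExact)
    (h : ∀ c : W ⟶ S.X₃, ∃ b : W ⟶ S.X₂, b ≫ S.g = c) : CovHomExact W S := by
  have := hS.mono_f
  exact ⟨fun a b hab => (cancel_mono S.f).1 hab,
    fun b hb => ⟨hS.exact.lift b hb, hS.exact.lift_f b hb⟩, h⟩

lemma pullbackComplex_eProper {E : 𝒜 → Prop} {S : ShortComplex 𝒜} (hS : S.ShortExact)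
    (hE : EProper E S) {Y : 𝒜} (h : Y ⟶ S.X₃) : EProper E (pullbackComplex S h) := by
  intro W hW
  refine covHomExact_of_shortExact (pullbackComplex_shortExact hS h) fun c => ?_
  obtain ⟨b, hb⟩ := (hE W hW).2.2 (c ≫ h)
  exact ⟨pullback.lift b c hb, pullback.lift_snd _ _ _⟩

/-- If `0 → Y → X → Q → 0` is exact and `B ⟶ X` is epi, then
`0 → B ×[X] Y → B → Q → 0` is exact. -/
lemma pullback_fst_shortExact {B X : 𝒜} (g : B ⟶ X) [Epi g] {Y Q : 𝒜} {h : Y ⟶ X} {q : X ⟶ Q}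
    {w : h ≫ q = 0} (hS : (ShortComplex.mk h q w).ShortExact) :
    (ShortComplex.mk (pullback.fst g h) (g ≫ q)
      (by rw [pullback.condition_assoc, w, comp_zero])).ShortExact := by
  have : Mono h := hS.mono_f
  have : Epi q := hS.epi_g
  have : Epi (g ≫ q) := epi_comp _ _
  refine ⟨ShortComplex.exact_of_f_is_kernel _
    (KernelFork.IsLimit.ofι' _ _ fun {W} k hk =>
      ⟨pullback.lift k (hS.exact.lift (k ≫ g) (by simpa using hk)) ?_, ?_⟩)⟩
  · exact (hS.exact.lift_f _ _).symm
  · exact pullback.lift_fst _ _ _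

end Pullback

section Codimension

variable {𝒜 : Type u} [Category.{v} 𝒜] [Abelian 𝒜]

lemma cores_mono {P Q : 𝒜 → Prop} (h : ∀ ⦃X⦄, P X → Q X) :
    ∀ (n : ℕ) {A K : 𝒜}, Cores P n A K → Cores Q n A K
  | 0, _, _, hA => hA
  | n + 1, _, _, ⟨X, B, f, g, w, hX, hS, _, hB⟩ =>
    ⟨X, B, f, g, w, h hX, hS, trivial, cores_mono h n hB⟩

lemma rcodim_anti {P Q : 𝒜 → Prop} (h : ∀ ⦃X⦄, P X → Q X) (A : 𝒜) :
    rcodim Q A ≤ rcodim P A := by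
  refine sInf_le_sInf ?_
  rintro c ⟨n, hn, K, hK, hA⟩
  exact ⟨n, hn, K, h hK, cores_mono h n hA⟩

lemma cores_of_iso {P : 𝒜 → Prop} (n : ℕ) {A A' K : 𝒜} (e : A' ≅ A) (h : Cores P n A K) :
    Cores P n A' K := by
  cases n with
  | zero => exact h.map fun i => e ≪≫ i
  | succ n =>
    obtain ⟨X, B, f, g, w, hX, hS, _, hB⟩ := h
    refine ⟨X, B, e.hom ≫ f, g, by simp [w], hX, ?_, trivial, hB⟩
    exact ShortComplex.shortExact_of_iso (S₁ := ShortComplex.mk f g w)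
      (ShortComplex.isoMk e.symm (Iso.refl _) (Iso.refl _) (by simp) (by simp)) hS

lemma rcodim_le {P : 𝒜 → Prop} {n : ℕ} {A K : 𝒜} (hK : P K) (h : Cores P n A K) :
    rcodim P A ≤ n :=
  sInf_le ⟨n, rfl, K, hK, h⟩

lemma exists_cores_of_rcodim_lt_top {P : 𝒜 → Prop} {A : 𝒜} (h : rcodim P A < ⊤) :
    ∃ n : ℕ, rcodim P A = n ∧ ∃ K, P K ∧ Cores P n A K := by
  refine csInf_mem (s := {c : ℕ∞ | ∃ n : ℕ, c = n ∧ ∃ K, P K ∧ Cores P n A K}) ?_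
  obtain ⟨c, hc, -⟩ := sInf_lt_iff.1 h
  exact ⟨c, hc⟩

lemma exists_res_of_rdim_lt_top {P : 𝒜 → Prop} {A : 𝒜} (h : rdim P A < ⊤) :
    ∃ n : ℕ, ∃ K, P K ∧ Res P n K A := by
  obtain ⟨c, ⟨n, -, hn⟩, -⟩ := sInf_lt_iff.1 h
  exact ⟨n, hn⟩

/-- Over a preresolving class `T` with proper generator `C`, an object with a `T`-coresolution
of length `n` is a proper quotient, with kernel in `T`, of an object with a `C`-coresolution
of length `n`. -/
lemma exists_proper_cover_of_cores {E T C : 𝒜 → Prop} (hT : IsAdditiveClass T)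
    (hpre : IsPreresolving E T C) (n : ℕ) :
    ∀ M : 𝒜, (∃ L, T L ∧ Cores T n M L) →
      ∃ S : ShortComplex 𝒜, S.X₃ = M ∧ T S.X₁ ∧ (∃ L, C L ∧ Cores C n S.X₂ L) ∧
        S.ShortExact ∧ EProper E S := by
  induction n with
  | zero =>
    rintro M ⟨L, hL, ⟨e⟩⟩
    obtain ⟨X', Cb, f, g, w, hCb, hX', hS, hE⟩ := hpre.1.2 M (hT.2.1 e.symm hL)
    exact ⟨ShortComplex.mk f g w, rfl, hX', ⟨Cb, hCb, ⟨Iso.refl _⟩⟩, hS, hE⟩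
  | succ n ih =>
    rintro M ⟨L, hL, T₀, B, i, p, w, hT₀, hS, -, hB⟩
    obtain ⟨R, rfl, hR₁, ⟨L', hL', hR₂⟩, hRS, hRE⟩ := ih B ⟨L, hL, hB⟩
    have hY : T (pullback R.g p) :=
      hpre.2 _ (pullbackComplex_shortExact hRS p) (pullbackComplex_eProper hRS hRE p) hR₁ hT₀
    obtain ⟨X', Cb, f, g, w', hCb, hX', hS', hE'⟩ := hpre.1.2 _ hY
    have : Epi g := hS'.epi_g
    have hM : (ShortComplex.mk (pullback.lift (f := R.g) (g := p) 0 i (by simp [w]))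
        (pullback.fst R.g p) (pullback.lift_fst _ _ _)).ShortExact :=
      ShortComplex.shortExact_of_iso
        (S₁ := pullbackComplex (ShortComplex.mk i p w) R.g) (ShortComplex.isoMk (Iso.refl _)
        (pullbackSymmetry p R.g) (Iso.refl _)
        (by apply pullback.hom_ext <;> simp [pullback.lift_fst, pullback.lift_snd])
        (by simp))
        (pullbackComplex_shortExact hS R.g)
    refine ⟨pullbackComplex (ShortComplex.mk f g w')
      (pullback.lift (f := R.g) (g := p) 0 i (by simp [w])), rfl, hX',
      ⟨L', hL', Cb, R.X₂, _, _, _, hCb, pullback_fst_shortExact g hM, trivial, hR₂⟩,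
      pullbackComplex_shortExact hS' _, pullbackComplex_eProper hS' hE' _⟩

end Codimension

section Ext

variable {𝒜 : Type u} [Category.{v} 𝒜] [Abelian 𝒜] [HasExt.{w} 𝒜]

lemma ext_subsingleton_of_iso {X X' : 𝒜} (e : X ≅ X') {Y : 𝒜} {i : ℕ}
    (h : Subsingleton (Ext X' Y i)) : Subsingleton (Ext X Y i) := by
  refine subsingleton_of_forall_eq 0 fun x => ?_
  have hx : (Ext.mk₀ e.inv).comp x (zero_add i) = 0 := Subsingleton.elim _ _
  have hx' := congrArg (fun y => (Ext.mk₀ e.hom).comp y (zero_add i)) hx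
  simpa using hx'

/-- Vanishing of `Ext^i(-, Y)` passes from all the terms of a finite coresolution to the
coresolved object. -/
lemma memLeftPerp_of_cores {P Q : 𝒜 → Prop} (hPQ : ∀ X, P X → MemLeftPerp Q X) (n : ℕ) :
    ∀ {A K : 𝒜}, P K → Cores P n A K → MemLeftPerp Q A := by
  induction n with
  | zero =>
    rintro A K hK ⟨e⟩ Y hY i hi
    exact ext_subsingleton_of_iso e (hPQ K hK Y hY i hi)
  | succ n ih =>
    rintro A K hK ⟨X, B, f, g, w, hX, hS, -, hB⟩ Y hY i hi
    refine subsingleton_of_forall_eq 0 fun x => ?_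
    have h₁ := hPQ X hX Y hY i hi
    have h₂ := ih hK hB Y hY (1 + i) (by omega)
    obtain ⟨y, hy⟩ := Ext.contravariant_sequence_exact₁ hS Y x rfl (Subsingleton.elim _ _)
    rw [← hy, Subsingleton.elim y 0, Ext.comp_zero]

/-- If `A` has a `P`-resolution of length `n` and `Y ∈ P^⊥`, then `Ext^i(A, Y) = 0`
for `i > n`. -/
lemma ext_subsingleton_of_res {P : 𝒜 → Prop} {Y : 𝒜} (hY : MemRightPerp P Y) (n : ℕ) :
    ∀ {A K : 𝒜}, P K → Res P n K A → ∀ i, n < i → Subsingleton (Ext A Y i) := by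
  induction n with
  | zero =>
    rintro A K hK ⟨e⟩ i hi
    exact ext_subsingleton_of_iso e.symm (hY K hK i hi)
  | succ n ih =>
    rintro A K hK ⟨B, X, f, g, w, hX, hS, -, hB⟩ i hi
    obtain ⟨j, rfl⟩ : ∃ j, i = 1 + j := ⟨i - 1, by omega⟩
    refine subsingleton_of_forall_eq 0 fun x => ?_
    have h₁ := hY X hX (1 + j) (by omega)
    have h₂ := ih hK hB j (by omega)
    obtain ⟨y, hy⟩ := Ext.contravariant_sequence_exact₃ hS Y x (Subsingleton.elim _ _) rfl
    rw [← hy, Subsingleton.elim y 0, Ext.comp_zero]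

/-- Dimension shifting along a generator `C` of `T`: if `M ∈ ^⊥C` and the groups
`Ext^i(M, Y)` with `Y` in `T` vanish in large degrees, they vanish in all positive degrees. -/
lemma memLeftPerp_of_generator {E T C : 𝒜 → Prop} (hgen : IsProperGenerator E C T) {M : 𝒜}
    (hM : MemLeftPerp C M) {n : ℕ}
    (hn : ∀ Y, T Y → ∀ i, n < i → Subsingleton (Ext M Y i)) : MemLeftPerp T M := by
  suffices h : ∀ k : ℕ, ∀ Y, T Y → ∀ i, 1 ≤ i → n < i + k → Subsingleton (Ext M Y i) from
    fun Y hY i hi => h n Y hY i hi (by omega)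
  intro k
  induction k with
  | zero => exact fun Y hY i _ hi => hn Y hY i hi
  | succ k ih =>
    intro Y hY i hi hik
    obtain ⟨Y', Cb, f, g, w, hCb, hY', hS, -⟩ := hgen.2 Y hY
    refine subsingleton_of_forall_eq 0 fun x => ?_
    have h₁ := hM Cb hCb i hi
    have h₂ := ih Y' hY' (i + 1) (by omega) (by omega)
    obtain ⟨y, hy⟩ := Ext.covariant_sequence_exact₃ M hS x rfl (Subsingleton.elim _ _)
    rw [← hy, Subsingleton.elim y 0, Ext.zero_comp]

lemma nonempty_iso_biprod_of_ext_one {S : ShortComplex 𝒜} (hS : S.ShortExact)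
    (h : Subsingleton (Ext S.X₃ S.X₁ 1)) : Nonempty (S.X₂ ≅ S.X₁ ⊞ S.X₃) := by
  obtain ⟨y, hy⟩ := Ext.covariant_sequence_exact₃ S.X₃ hS (Ext.mk₀ (𝟙 S.X₃)) (zero_add 1)
    (Subsingleton.elim _ _)
  obtain ⟨s, rfl⟩ := Ext.homEquiv₀.symm.surjective y
  have hs : s ≫ S.g = 𝟙 S.X₃ := by
    apply Ext.homEquiv₀.symm.injective
    simpa [← Ext.mk₀_comp_mk₀] using hy
  have := hS.mono_f
  exact ⟨(ShortComplex.Splitting.ofExactOfSection S hS.exact s hs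
    inferInstance).isoBinaryBiproduct⟩

end Ext

end RelHomDim

open RelHomDim in
/-- Theorem 3.11. -/
theorem stmt13 {𝒜 : Type u} [Category.{v} 𝒜] [Abelian 𝒜] [HasExt.{w} 𝒜]
    (ℰ 𝒯 𝒞 𝒟 : 𝒜 → Prop) (hℰ : IsAdditiveClass ℰ) (h𝒯 : IsAdditiveClass 𝒯)
    (h𝒞 : IsAdditiveClass 𝒞) (h𝒟 : IsAdditiveClass 𝒟)
    (hpre : IsPreresolving ℰ 𝒯 𝒞)
    (hsub : ∀ X : 𝒜, 𝒯 X → MemLeftPerp 𝒞 X ∧ MemRightPerp 𝒟 X)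
    (hsum : ∀ n : ℕ, ClosedUnderSummands (fun X : 𝒜 => rcodim 𝒞 X ≤ (n : ℕ∞)))
    (M : 𝒜) (hM : rdim 𝒟 M < ⊤) :
    rcodim 𝒯 M = rcodim 𝒞 M := by
  refine le_antisymm (rcodim_anti hpre.1.1 M) ?_
  rcases eq_or_ne (rcodim 𝒯 M) ⊤ with htop | htop
  · simp [htop]
  obtain ⟨n, hn, L, hL, hML⟩ := exists_cores_of_rcodim_lt_top (lt_top_iff_ne_top.2 htop)
  obtain ⟨m, D, hD, hDM⟩ := exists_res_of_rdim_lt_top hM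
  have hperp : MemLeftPerp 𝒯 M := memLeftPerp_of_generator hpre.1
    (memLeftPerp_of_cores (fun X hX => (hsub X hX).1) n hL hML)
    fun Y hY => ext_subsingleton_of_res (hsub Y hY).2 m hD hDM
  obtain ⟨S, rfl, hS₁, ⟨K, hK, hS₂⟩, hS, -⟩ :=
    exists_proper_cover_of_cores h𝒯 hpre n M ⟨L, hL, hML⟩
  obtain ⟨e⟩ := nonempty_iso_biprod_of_ext_one hS (hperp _ hS₁ 1 le_rfl)
  rw [hn]
  exact (hsum n _ _ (rcodim_le hK (cores_of_iso n e.symm hS₂))).2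
end
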